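/- Let β and ρ be simple closed curves in ℝ² that have at least 4 points in common. If (α, γ) and (α′, γ′) are distinct digons of (β, ρ), then α ≠ α′ and γ ≠ γ′. -/

import Mathlib

/-- A simple closed curve: a subset of ℝ² homeomorphic to the unit circle. -/
def IsSimpleClosedCurve (c : Set (ℝ × ℝ)) : Prop :=
  Nonempty (c ≃ₜ Metric.sphere (0 : EuclideanSpace ℝ (Fin 2)) 1)

/-- An arc: a subset of ℝ² homeomorphic to the closed interval [0,1]. -/
def IsArc (A : Set (ℝ × ℝ)) : Prop :=
  Nonempty (A ≃ₜ Set.Icc (0 : ℝ) 1)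

/-- `a` is an endpoint of the arc `A` : `a ∈ A` and `A \ {a}` is connected. -/
def IsEndpointOf (a : ℝ × ℝ) (A : Set (ℝ × ℝ)) : Prop :=
  a ∈ A ∧ IsConnected (A \ {a})

/-- A digon of the pair of simple closed curves `(β, ρ)`. -/
def IsDigon (β ρ α γ : Set (ℝ × ℝ)) : Prop :=
  IsArc α ∧ IsArc γ ∧ α ⊆ β ∧ γ ⊆ ρ ∧
  ∃ x y : ℝ × ℝ, x ≠ y ∧
    {a | IsEndpointOf a α} = {x, y} ∧
    {a | IsEndpointOf a γ} = {x, y} ∧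
    β ∩ γ = {x, y} ∧
    ρ ∩ α = {x, y}

/-- `z` is a crossing of `β` and `ρ`. -/
def IsCrossing (β ρ : Set (ℝ × ℝ)) (z : ℝ × ℝ) : Prop :=
  ∃ (U : Set (ℝ × ℝ)) (_ : IsOpen U) (hz : z ∈ U) (h : U ≃ₜ ℝ × ℝ),
    h ⟨z, hz⟩ = (0, 0) ∧
    ⇑h '' {p : U | (p : ℝ × ℝ) ∈ β} = {q : ℝ × ℝ | q.2 = 0} ∧
    ⇑h '' {p : U | (p : ℝ × ℝ) ∈ ρ} = {q : ℝ × ℝ | q.1 = 0}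

/-- `z` is a tangential intersection of `β` and `ρ`. -/
def IsTangential (β ρ : Set (ℝ × ℝ)) (z : ℝ × ℝ) : Prop :=
  ∃ (U : Set (ℝ × ℝ)) (_ : IsOpen U) (hz : z ∈ U) (h : U ≃ₜ ℝ × ℝ),
    h ⟨z, hz⟩ = (0, 0) ∧
    ⇑h '' {p : U | (p : ℝ × ℝ) ∈ β} = {q : ℝ × ℝ | q.2 = 0} ∧
    ⇑h '' {p : U | (p : ℝ × ℝ) ∈ ρ} ⊆ {q : ℝ × ℝ | 0 ≤ q.2} ∧
    ⇑h '' {p : U | (p : ℝ × ℝ) ∈ ρ} ∩ {q : ℝ × ℝ | q.2 = 0} = {((0 : ℝ), (0 : ℝ))}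

/-- The complement of a point in a simple closed curve injects continuously into the line. -/
lemma IsSimpleClosedCurve.exists_continuousOn_injOn {c : Set (ℝ × ℝ)}
    (hc : IsSimpleClosedCurve c) {p : ℝ × ℝ} (hp : p ∈ c) :
    ∃ f : ℝ × ℝ → ℝ, ContinuousOn f (c \ {p}) ∧ Set.InjOn f (c \ {p}) := by
  classical
  obtain ⟨h⟩ := hc
  have : Fact (Module.finrank ℝ (EuclideanSpace ℝ (Fin 2)) = 1 + 1) := ⟨by simp⟩
  let e := stereographic' 1 (h ⟨p, hp⟩)
  let f : ℝ × ℝ → ℝ := fun q => if hq : q ∈ c then e (h ⟨q, hq⟩) 0 else 0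
  have mem_source : ∀ q (hq : q ∈ c \ {p}), h ⟨q, hq.1⟩ ∈ e.source := by
    intro q hq
    simp only [e, stereographic'_source, Set.mem_compl_iff, Set.mem_singleton_iff]
    intro heq
    exact hq.2 (congrArg Subtype.val (h.injective heq))
  have f_apply : ∀ q (hq : q ∈ c), f q = e (h ⟨q, hq⟩) 0 := fun q hq => dif_pos hq
  refine ⟨f, ?_, ?_⟩
  · rw [continuousOn_iff_continuous_domRestrict]
    have hcont : Continuous fun q : ↥(c \ {p}) => e (h ⟨q, q.2.1⟩) :=
      e.continuousOn.comp_continuous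
        (h.continuous.comp (by fun_prop)) fun q => mem_source q q.2
    have hcoord : Continuous fun v : EuclideanSpace ℝ (Fin 1) => v 0 := by fun_prop
    exact (hcoord.comp hcont).congr fun q => (f_apply q q.2.1).symm
  · intro q hq r hr hqr
    rw [f_apply q hq.1, f_apply r hr.1] at hqr
    have heq : e (h ⟨q, hq.1⟩) = e (h ⟨r, hr.1⟩) := by
      ext i
      rwa [Subsingleton.elim i 0]
    exact congrArg Subtype.val
      (h.injective (e.injOn (mem_source q hq) (mem_source r hr) heq))

lemma IsArc.isCompact {A : Set (ℝ × ℝ)} (hA : IsArc A) : IsCompact A := by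
  obtain ⟨h⟩ := hA
  have := h.symm.compactSpace
  exact isCompact_iff_compactSpace.mpr inferInstance

lemma IsArc.isConnected {A : Set (ℝ × ℝ)} (hA : IsArc A) : IsConnected A := by
  obtain ⟨h⟩ := hA
  have : ConnectedSpace (Set.Icc (0 : ℝ) 1) :=
    isConnected_iff_connectedSpace.mp (isConnected_Icc zero_le_one)
  have := h.symm.surjective.connectedSpace h.symm.continuous
  exact isConnected_iff_connectedSpace.mpr inferInstance

/-- Connectedness of a subset of a compact set can be tested on its image under a continuous
injection. -/
lemma IsCompact.isConnected_of_image {X Y : Type*} [TopologicalSpace X] [TopologicalSpace Y]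
    [T2Space Y] {A s : Set X} {f : X → Y} (hA : IsCompact A) (hf : ContinuousOn f A)
    (hinj : Set.InjOn f A) (hs : s ⊆ A) (hfs : IsConnected (f '' s)) : IsConnected s := by
  have := isCompact_iff_compactSpace.mp hA
  have hemb : Topology.IsClosedEmbedding (A.domRestrict f) :=
    (continuousOn_iff_continuous_domRestrict.mp hf).isClosedEmbedding
      (Set.injOn_iff_injective.mp hinj)
  have hval : Subtype.val '' (Subtype.val ⁻¹' s : Set A) = s := by
    rwa [Subtype.image_preimage_coe, Set.inter_eq_right]
  have himage : A.domRestrict f '' (Subtype.val ⁻¹' s) = f '' s := by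
    rw [Set.domRestrict_eq, Set.image_comp, hval]
  refine ⟨hfs.nonempty.of_image, ?_⟩
  rw [← hval]
  refine IsPreconnected.image ?_ _ continuous_subtype_val.continuousOn
  rw [← hemb.isInducing.isPreconnected_image, himage]
  exact hfs.isPreconnected

/-- A continuous injection of an arc into the line maps it onto the segment spanned by the images
of its endpoints. -/
lemma IsArc.image_eq_uIcc {A : Set (ℝ × ℝ)} (hA : IsArc A) {x y : ℝ × ℝ} (hxy : x ≠ y)
    (hend : {a | IsEndpointOf a A} = {x, y}) {f : ℝ × ℝ → ℝ} (hf : ContinuousOn f A)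
    (hinj : Set.InjOn f A) : f '' A = Set.uIcc (f x) (f y) := by
  have hx : x ∈ A := (hend.ge (Set.mem_insert x {y}) : IsEndpointOf x A).1
  have hy : y ∈ A := (hend.ge (Set.mem_insert_of_mem x rfl) : IsEndpointOf y A).1
  have himage := eq_Icc_of_connected_compact (hA.isConnected.image f hf)
    (hA.isCompact.image_of_continuousOn hf)
  set u := sInf (f '' A)
  set v := sSup (f '' A)
  have hfx : f x ∈ Set.Icc u v := himage ▸ Set.mem_image_of_mem f hx
  have hfy : f y ∈ Set.Icc u v := himage ▸ Set.mem_image_of_mem f hy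
  have hfxy : f x ≠ f y := fun h => hxy (hinj hx hy h)
  have huv : u < v := by
    rcases lt_or_gt_of_ne hfxy with h | h
    · exact hfx.1.trans_lt (h.trans_le hfy.2)
    · exact hfy.1.trans_lt (h.trans_le hfx.2)
  have endpoint : ∀ t ∈ Set.Icc u v, IsConnected (Set.Icc u v \ {t}) → t = f x ∨ t = f y := by
    intro t ht hconn
    rw [← himage] at ht
    obtain ⟨a, ha, rfl⟩ := ht
    have hcut : IsConnected (A \ {a}) := by
      refine hA.isCompact.isConnected_of_image hf hinj Set.sdiff_subset ?_
      rwa [hinj.image_sdiff_subset (Set.singleton_subset_iff.mpr ha), Set.image_singleton, himage]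
    rcases hend.le (show IsEndpointOf a A from ⟨ha, hcut⟩) with h | h
    · exact Or.inl (congrArg f h)
    · exact Or.inr (congrArg f h)
  have hu := endpoint u (Set.left_mem_Icc.mpr huv.le)
    (by rw [Set.Icc_sdiff_left]; exact isConnected_Ioc huv)
  have hv := endpoint v (Set.right_mem_Icc.mpr huv.le)
    (by rw [Set.Icc_sdiff_right]; exact isConnected_Ico huv)
  rw [himage]
  rcases hu with hu | hu <;> rcases hv with hv | hv
  · exact absurd (hu.trans hv.symm) huv.ne
  · rw [← hu, ← hv, Set.uIcc_of_le huv.le]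
  · rw [← hu, ← hv, Set.uIcc_of_ge huv.le]
  · exact absurd (hu.trans hv.symm) huv.ne

/-- Two distinct arcs with the same endpoints in a simple closed curve cover the curve. -/
lemma IsSimpleClosedCurve.eq_or_subset_union {c A B : Set (ℝ × ℝ)}
    (hc : IsSimpleClosedCurve c) (hA : IsArc A) (hB : IsArc B) (hAc : A ⊆ c) (hBc : B ⊆ c)
    {x y : ℝ × ℝ} (hxy : x ≠ y) (hendA : {a | IsEndpointOf a A} = {x, y})
    (hendB : {a | IsEndpointOf a B} = {x, y}) : A = B ∨ c ⊆ A ∪ B := by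
  by_contra! hcon
  obtain ⟨hne, hcover⟩ := hcon
  obtain ⟨p, hp, hpAB⟩ := Set.not_subset.mp hcover
  obtain ⟨f, hf, hinj⟩ := hc.exists_continuousOn_injOn hp
  have hA' : A ⊆ c \ {p} := fun q hq => ⟨hAc hq, fun h => hpAB (Or.inl (h ▸ hq))⟩
  have hB' : B ⊆ c \ {p} := fun q hq => ⟨hBc hq, fun h => hpAB (Or.inr (h ▸ hq))⟩
  refine hne ((hinj.image_eq_image_iff hA' hB').mp ?_)
  rw [hA.image_eq_uIcc hxy hendA (hf.mono hA') (hinj.mono hA'),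
    hB.image_eq_uIcc hxy hendB (hf.mono hB') (hinj.mono hB')]

lemma IsDigon.symm {β ρ α γ : Set (ℝ × ℝ)} (h : IsDigon β ρ α γ) : IsDigon ρ β γ α := by
  obtain ⟨hα, hγ, hαβ, hγρ, x, y, hxy, hendα, hendγ, hβγ, hρα⟩ := h
  exact ⟨hγ, hα, hγρ, hαβ, x, y, hxy, hendγ, hendα, hρα, hβγ⟩

/-- If two simple closed curves have more than two common points, a digon is determined by its
first arc. -/
lemma IsDigon.right_unique {β ρ α γ γ' : Set (ℝ × ℝ)} (hρ : IsSimpleClosedCurve ρ)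
    (hcard : 2 < (β ∩ ρ).encard) (h : IsDigon β ρ α γ) (h' : IsDigon β ρ α γ') : γ = γ' := by
  obtain ⟨-, hγ, -, hγρ, x, y, hxy, hendα, hendγ, hβγ, -⟩ := h
  obtain ⟨-, hγ', -, hγρ', x', y', -, hendα', hendγ', hβγ', -⟩ := h'
  have hpair : ({x', y'} : Set (ℝ × ℝ)) = {x, y} := hendα'.symm.trans hendα
  rw [hpair] at hendγ' hβγ'
  refine (hρ.eq_or_subset_union hγ hγ' hγρ hγρ' hxy hendγ hendγ').resolve_right fun hcover => ?_
  have hsub : β ∩ ρ ⊆ {x, y} :=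
    calc β ∩ ρ ⊆ β ∩ (γ ∪ γ') := Set.inter_subset_inter_right β hcover
      _ = {x, y} := by rw [Set.inter_union_distrib_left, hβγ, hβγ', Set.union_self]
  exact hcard.not_ge ((Set.encard_le_encard hsub).trans (Set.encard_pair hxy).le)

/-- If two simple closed curves have at least 4 points in common, then distinct digons of the
pair have distinct first arcs and distinct second arcs. -/
theorem distinct_digons_have_distinct_arcs
    (β ρ : Set (ℝ × ℝ))
    (hβ : IsSimpleClosedCurve β) (hρ : IsSimpleClosedCurve ρ)
    (h4 : 4 ≤ (β ∩ ρ).encard)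
    (α γ α' γ' : Set (ℝ × ℝ))
    (h1 : IsDigon β ρ α γ) (h2 : IsDigon β ρ α' γ')
    (hne : (α, γ) ≠ (α', γ')) :
    α ≠ α' ∧ γ ≠ γ' := by
  have hcard : 2 < (β ∩ ρ).encard := lt_of_lt_of_le (by norm_num) h4
  constructor
  · rintro rfl
    exact hne (Prod.ext rfl (h1.right_unique hρ hcard h2))
  · rintro rfl
    rw [Set.inter_comm] at hcard
    exact hne (Prod.ext (h1.symm.right_unique hβ hcard h2.symm) rfl)
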